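/- (Uniform accuracy of the explicit Euler scheme for the micro-macro problem.) Assume ω ∈ ℝ^r satisfies the Diophantine condition with constants c_D > 0 and ν > 0. Let μ > 0, M > 0, C_a > 0, c ∈ (0,1), and let a : [0,∞) → End(X) be sharp-flat of class μ with 𝒩_μ(a) ≤ M, of class C¹ with sup_{τ≥0} |a_τ| ≤ C_a M and sup_{τ≥0} |∂_τ a_τ| ≤ C_a M. Let n ≥ 1, T > 0 and u₀ ∈ X. Then there exist ε_n > 0 and C > 0 such that for every ε ∈ (0, ε_n] there are a C² map Φ : [0,∞) → End(X) with sup_τ|Φ_τ − id| ≤ c (so that Φ₀ is invertible) and A ∈ End(X) with the following property: defining δ_τ := ε^{-1}∂_τΦ_τ − (a_τΦ_τ − Φ_τA), and, for any positive integer L, setting Δt = T/L, t^ℓ = ℓΔt, v⁰ = (Φ₀)^{-1}u₀, w⁰ = 0, and iterating the explicit Euler scheme v^{ℓ+1} = v^ℓ + Δt A v^ℓ, w^{ℓ+1} = w^ℓ + Δt (a_{t^ℓ/ε} w^ℓ − δ_{t^ℓ/ε} v^ℓ), one has max_{0≤ℓ≤L} |Φ_{t^ℓ/ε} v^ℓ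 + w^ℓ − u^ε(t^ℓ)| ≤ C Δt, where u^ε : [0,T] → X is the solution of ∂_t u^ε(t) = a_{t/ε} u^ε(t), u^ε(0) = u₀, and C is independent of ε and of L. -/

import Mathlib

open scoped BigOperators
open Filter MeasureTheory

noncomputable section

variable {X : Type*} [NormedAddCommGroup X] [NormedSpace ℂ X] [CompleteSpace X]

/-- `|α| = |α₁| + ⋯ + |α_r|` for a multi-index `α ∈ ℤ^r`. -/
def absIdx {r : ℕ} (α : Fin r → ℤ) : ℝ := ∑ i, |(α i : ℝ)|

/-- `α · ω = α₁ω₁ + ⋯ + α_rω_r`. -/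
def dotIdx {r : ℕ} (ω : Fin r → ℝ) (α : Fin r → ℤ) : ℝ := ∑ i, (α i : ℝ) * ω i

/-- The quasi-periodic ("sharp") map generated by a family of Fourier coefficients:
`τ ↦ Σ_α e^{i(α·ω)τ} φ̂_α`. -/
def sharpSum {r : ℕ} (ω : Fin r → ℝ) (φhat : (Fin r → ℤ) → (X →L[ℂ] X)) (τ : ℝ) :
    X →L[ℂ] X :=
  ∑' α : Fin r → ℤ, Complex.exp (Complex.I * (dotIdx ω α : ℂ) * (τ : ℂ)) • φhat α

/-- The weighted ℓ¹-norm `Σ_α e^{κ|α|} ‖φ̂_α‖` of a family of Fourier coefficients. -/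
def sharpNorm {r : ℕ} (κ : ℝ) (φhat : (Fin r → ℤ) → (X →L[ℂ] X)) : ℝ :=
  ∑' α : Fin r → ℤ, Real.exp (κ * absIdx α) * ‖φhat α‖

/-- `sup_{τ ≥ 0} e^τ ‖φ♭_τ‖` for the exponentially decaying ("flat") part. -/
def flatSup (φflat : ℝ → (X →L[ℂ] X)) : ℝ :=
  ⨆ τ : Set.Ici (0:ℝ), Real.exp (τ : ℝ) * ‖φflat (τ : ℝ)‖

/-- The sharp-flat norm `𝒩_κ(φ) = Σ_α e^{κ|α|}‖φ̂_α‖ + sup_{τ≥0} e^τ‖φ♭_τ‖`. -/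
def SFNorm {r : ℕ} (κ : ℝ) (φhat : (Fin r → ℤ) → (X →L[ℂ] X))
    (φflat : ℝ → (X →L[ℂ] X)) : ℝ :=
  sharpNorm κ φhat + flatSup φflat

/-- `φ : [0,∞) → End(X)` is sharp-flat of class `κ`, with sharp Fourier coefficients
`φhat` and flat part `φflat`. -/
structure IsSharpFlat {r : ℕ} (ω : Fin r → ℝ) (κ : ℝ) (φ : ℝ → (X →L[ℂ] X))
    (φhat : (Fin r → ℤ) → (X →L[ℂ] X)) (φflat : ℝ → (X →L[ℂ] X)) : Prop where
  summable : Summable fun α : Fin r → ℤ => Real.exp (κ * absIdx α) * ‖φhat α‖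
  flat_cont : ContinuousOn φflat (Set.Ici 0)
  flat_bdd : BddAbove (Set.range fun τ : Set.Ici (0:ℝ) => Real.exp (τ : ℝ) * ‖φflat (τ : ℝ)‖)
  decomp : ∀ τ : ℝ, 0 ≤ τ → φ τ = sharpSum ω φhat τ + φflat τ

/-- The time average `⟨φ⟩ = lim_{T→∞} (1/T) ∫₀^T φ_σ dσ` equals `B`. -/
def HasTimeAvg {E : Type*} [NormedAddCommGroup E] [NormedSpace ℝ E] (φ : ℝ → E) (B : E) : Prop :=
  Tendsto (fun T : ℝ => (1 / T) • ∫ σ in (0:ℝ)..T, φ σ) atTop (nhds B)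

/-- The constant `c_I(κ) = max{1, (1/c_D)(ν/(κe))^ν}` from the integration lemma. -/
def cI (c_D ν κ : ℝ) : ℝ := max 1 ((1 / c_D) * (ν / (κ * Real.exp 1)) ^ ν)

lemma clm_apply_deriv {X : Type*} [NormedAddCommGroup X] [NormedSpace ℂ X]
    {c : ℝ → (X →L[ℂ] X)} {c' : X →L[ℂ] X} {u : ℝ → X} {u' : X} {s : Set ℝ} {t : ℝ}
    (hc : HasDerivWithinAt c c' s t) (hu : HasDerivWithinAt u u' s t) :
    HasDerivWithinAt (fun y => (c y) (u y)) (c' (u t) + (c t) u') s t := by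
  have h1 : HasDerivWithinAt (fun y => ContinuousLinearMap.restrictScalarsL ℂ X X ℝ ℝ (c y))
      (ContinuousLinearMap.restrictScalarsL ℂ X X ℝ ℝ c') s t :=
    (ContinuousLinearMap.restrictScalarsL ℂ X X ℝ ℝ).hasFDerivAt.comp_hasDerivWithinAt t hc
  exact h1.clm_apply hu

lemma taylor_lip {E : Type*} [NormedAddCommGroup E] [NormedSpace ℝ E] {f f' : ℝ → E} {T Q t h : ℝ}
    (hQ : 0 ≤ Q) (hf : ∀ s ∈ Set.Icc 0 T, HasDerivWithinAt f (f' s) (Set.Icc 0 T) s)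
    (hl : ∀ s ∈ Set.Icc 0 T, ∀ s' ∈ Set.Icc 0 T, ‖f' s - f' s'‖ ≤ Q * |s - s'|)
    (ht : 0 ≤ t) (hh : 0 ≤ h) (hT : t + h ≤ T) :
    ‖f (t + h) - f t - h • f' t‖ ≤ Q * h ^ 2 := by
  have hsub : Set.Icc t (t + h) ⊆ Set.Icc 0 T := Set.Icc_subset_Icc ht hT
  have key := Convex.norm_image_sub_le_of_norm_hasDerivWithin_le (𝕜 := ℝ)
    (f := fun s => f s - s • f' t) (f' := fun s => f' s - (1 : ℝ) • f' t)
    (s := Set.Icc t (t + h)) (x := t) (y := t + h) (C := Q * h)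
    (fun s hs => ((hf s (hsub hs)).mono hsub).sub ((hasDerivWithinAt_id s _).smul_const (f' t)))
    (fun s hs => by
      rw [one_smul]
      refine (hl s (hsub hs) t (hsub ⟨le_rfl, by linarith⟩)).trans ?_
      refine mul_le_mul_of_nonneg_left ?_ hQ
      rw [abs_of_nonneg (by linarith [hs.1])]; linarith [hs.2])
    (convex_Icc _ _) ⟨le_rfl, by linarith⟩ ⟨by linarith, le_rfl⟩
  have e : f (t + h) - f t - h • f' t = f (t + h) - (t + h) • f' t - (f t - t • f' t) := by
    rw [add_smul]; abel
  rw [e]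
  refine key.trans (le_of_eq ?_)
  rw [Real.norm_eq_abs, add_sub_cancel_left, abs_of_nonneg hh]; ring

lemma euler_discrete_gronwall {e : ℕ → ℝ} {N : ℕ} {h P K : ℝ} (hh : 0 ≤ h) (hP : 0 ≤ P) (hK : 0 ≤ K)
    (h0 : e 0 = 0) (hs : ∀ l < N, e (l + 1) ≤ (1 + h * P) * e l + K * h ^ 2) :
    ∀ l ≤ N, e l ≤ K * h * (N * h) * Real.exp (P * (N * h)) := by
  have main : ∀ l ≤ N, e l ≤ l * (K * h ^ 2) * (1 + h * P) ^ l := by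
    intro l
    induction l with
    | zero => intro _; simp [h0]
    | succ l ih =>
      intro hl
      have h1 := ih (by omega)
      have h2 := hs l (by omega)
      have h3 : (1:ℝ) ≤ (1 + h * P) ^ (l + 1) := one_le_pow₀ (by nlinarith [mul_nonneg hh hP])
      have h4 : 0 ≤ 1 + h * P := by nlinarith [mul_nonneg hh hP]
      have h5 : 0 ≤ K * h ^ 2 := by positivity
      calc e (l + 1) ≤ (1 + h * P) * e l + K * h ^ 2 := h2
        _ ≤ (1 + h * P) * (l * (K * h ^ 2) * (1 + h * P) ^ l) + K * h ^ 2 * (1 + h * P) ^ (l + 1) :=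
            add_le_add (mul_le_mul_of_nonneg_left h1 h4) (by nlinarith)
        _ = _ := by push_cast; ring
  intro l hl
  have hlN : (l : ℝ) ≤ N := by exact_mod_cast hl
  have h4 : 0 ≤ 1 + h * P := by nlinarith [mul_nonneg hh hP]
  have hp : (1 + h * P) ^ l ≤ Real.exp (P * (N * h)) := by
    calc (1 + h * P) ^ l ≤ (Real.exp (h * P)) ^ l :=
          pow_le_pow_left₀ h4 (by linarith [Real.add_one_le_exp (h * P)]) _
      _ = Real.exp (l * (h * P)) := (Real.exp_nat_mul _ _).symm
      _ ≤ _ := Real.exp_le_exp.2 (by nlinarith [mul_nonneg hh hP])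
  calc e l ≤ l * (K * h ^ 2) * (1 + h * P) ^ l := main l hl
    _ ≤ N * (K * h ^ 2) * Real.exp (P * (N * h)) := by gcongr
    _ = _ := by ring

lemma rpow_le_mul_exp {ν μ x : ℝ} (hν : 0 < ν) (hμ : 0 < μ) (hx : 0 ≤ x) :
    x ^ ν ≤ (ν / μ) ^ ν * Real.exp (μ * x) := by
  have h1 : x = (ν / μ) * (μ * x / ν) := by field_simp
  have h2 : μ * x / ν ≤ Real.exp (μ * x / ν) := by linarith [Real.add_one_le_exp (μ * x / ν)]
  have h0 : 0 ≤ μ * x / ν := by positivity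
  calc x ^ ν = ((ν / μ) * (μ * x / ν)) ^ ν := by rw [← h1]
    _ = (ν / μ) ^ ν * (μ * x / ν) ^ ν := Real.mul_rpow (by positivity) h0
    _ ≤ (ν / μ) ^ ν * (Real.exp (μ * x / ν)) ^ ν := by gcongr
    _ = _ := by rw [← Real.exp_mul]; congr 2; field_simp

lemma absIdx_nonneg {r : ℕ} (α : Fin r → ℤ) : 0 ≤ absIdx α :=
  Finset.sum_nonneg fun _ _ => abs_nonneg _

lemma absIdx_pos {r : ℕ} {α : Fin r → ℤ} (h : α ≠ 0) : 0 < absIdx α := by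
  obtain ⟨i, hi⟩ := Function.ne_iff.1 h
  refine Finset.sum_pos' (fun _ _ => abs_nonneg _) ⟨i, Finset.mem_univ _, ?_⟩
  exact abs_pos.2 (by exact_mod_cast hi)

lemma osc_bound {X : Type*} [NormedAddCommGroup X] [NormedSpace ℂ X] [CompleteSpace X]
    (d τ : ℝ) (hd : d ≠ 0) (B : X →L[ℂ] X) :
    ‖∫ s in (0:ℝ)..τ, Complex.exp (Complex.I * (d : ℂ) * (s : ℂ)) • B‖ ≤ 2 / |d| * ‖B‖ := by
  have hc : Complex.I * (d : ℂ) ≠ 0 := mul_ne_zero Complex.I_ne_zero (by exact_mod_cast hd)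
  rw [intervalIntegral.integral_smul_const, integral_exp_mul_complex hc, norm_smul]
  gcongr
  rw [norm_div]
  have h1 : ‖Complex.I * (d : ℂ)‖ = |d| := by simp
  rw [h1]
  gcongr
  refine (norm_sub_le _ _).trans (le_of_eq ?_)
  have h2 : ∀ x : ℝ, ‖Complex.exp (Complex.I * (d : ℂ) * (x : ℂ))‖ = 1 := by
    intro x; rw [Complex.norm_exp]; simp
  rw [h2, h2]; norm_num

lemma norm_osc {X : Type*} [NormedAddCommGroup X] [NormedSpace ℂ X]
    (d s : ℝ) (B : X →L[ℂ] X) :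
    ‖Complex.exp (Complex.I * (d : ℂ) * (s : ℂ)) • B‖ = ‖B‖ := by
  have : ‖Complex.exp (Complex.I * (d : ℂ) * (s : ℂ))‖ = 1 := by
    rw [Complex.norm_exp]; simp
  rw [norm_smul, this, one_mul]

lemma avg_bound {X : Type*} [NormedAddCommGroup X] [NormedSpace ℂ X] [CompleteSpace X]
    {r : ℕ} (ω : Fin r → ℝ) (c_D ν : ℝ) (hcD : 0 < c_D) (hν : 0 < ν)
    (hdio : ∀ α : Fin r → ℤ, α ≠ 0 → c_D / (absIdx α) ^ ν ≤ |dotIdx ω α|)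
    (μ : ℝ) (hμ : 0 < μ)
    (a : ℝ → (X →L[ℂ] X))
    (ahat : (Fin r → ℤ) → (X →L[ℂ] X)) (aflat : ℝ → (X →L[ℂ] X))
    (ha : IsSharpFlat ω μ a ahat aflat) :
    ∃ B : ℝ, 0 < B ∧ ∀ τ : ℝ, 0 ≤ τ →
      ‖∫ s in (0:ℝ)..τ, (a (max s 0) - ahat 0)‖ ≤ B := by
  classical
  set K : ℝ := 2 / c_D * (ν / μ) ^ ν with hK
  have hK0 : 0 ≤ K := by positivity
  obtain ⟨F, hF⟩ := ha.flat_bdd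
  have hF' : ∀ s : ℝ, 0 ≤ s → ‖aflat s‖ ≤ F * Real.exp (-s) := by
    intro s hs
    have := hF ⟨⟨s, hs⟩, rfl⟩
    simp only at this
    rw [Real.exp_neg, ← div_eq_mul_inv, le_div_iff₀ (Real.exp_pos _)]
    linarith
  have hF0 : 0 ≤ F := by
    have := (norm_nonneg _).trans (hF' 0 le_rfl)
    simpa using this
  have hsum : Summable fun α => ‖ahat α‖ := by
    refine Summable.of_nonneg_of_le (fun _ => norm_nonneg _) (fun α => ?_) ha.summable
    exact le_mul_of_one_le_left (norm_nonneg _)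
      (Real.one_le_exp (mul_nonneg hμ.le (absIdx_nonneg α)))
  set f : (Fin r → ℤ) → ℝ → (X →L[ℂ] X) := fun α s =>
    if α = 0 then 0 else Complex.exp (Complex.I * (dotIdx ω α : ℂ) * (s : ℂ)) • ahat α with hf
  have hfn : ∀ α s, ‖f α s‖ ≤ ‖ahat α‖ := by
    intro α s
    simp only [hf]
    split_ifs
    · simp
    · exact (norm_osc _ _ _).le
  have hfc : ∀ α, Continuous (f α) := by
    intro α
    simp only [hf]
    split_ifs
    · exact continuous_const
    · fun_prop
  have hS : ∀ s : ℝ, sharpSum ω ahat s = ahat 0 + ∑' α, f α s := by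
    intro s
    have hs : Summable fun α : Fin r → ℤ =>
        Complex.exp (Complex.I * (dotIdx ω α : ℂ) * (s : ℂ)) • ahat α :=
      Summable.of_norm (by simpa only [norm_osc] using hsum)
    rw [sharpSum, hs.tsum_eq_add_tsum_ite 0]
    congr 1
    simp [dotIdx]
  have hSc : Continuous fun s => ∑' α, f α s := continuous_tsum hfc hsum hfn
  have hbound : ∀ α τ, ‖∫ s in (0:ℝ)..τ, f α s‖ ≤ K * (Real.exp (μ * absIdx α) * ‖ahat α‖) := by
    intro α τ
    by_cases h0 : α = 0
    · simp only [hf, h0, if_true]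
      simp only [intervalIntegral.integral_zero, norm_zero]
      positivity
    · simp only [hf, h0, if_false]
      have hp := absIdx_pos h0
      have hp' : 0 < (absIdx α) ^ ν := Real.rpow_pos_of_pos hp _
      have hd := hdio α h0
      have hd0 : 0 < |dotIdx ω α| := lt_of_lt_of_le (by positivity) hd
      refine (osc_bound _ τ (abs_pos.1 hd0) _).trans ?_
      rw [← mul_assoc]
      gcongr
      calc 2 / |dotIdx ω α| ≤ 2 / (c_D / (absIdx α) ^ ν) := by gcongr
        _ = 2 / c_D * (absIdx α) ^ ν := by field_simp
        _ ≤ 2 / c_D * ((ν / μ) ^ ν * Real.exp (μ * absIdx α)) := by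
          gcongr; exact rpow_le_mul_exp hν hμ hp.le
        _ = _ := by rw [hK]; ring
  have hsK := ha.summable.mul_left K
  refine ⟨∑' α, K * (Real.exp (μ * absIdx α) * ‖ahat α‖) + F + 1, ?_, ?_⟩
  · have : 0 ≤ ∑' α, K * (Real.exp (μ * absIdx α) * ‖ahat α‖) := tsum_nonneg fun α => by positivity
    linarith
  intro τ hτ
  have hflc : Continuous fun s => aflat (max s 0) :=
    ha.flat_cont.comp_continuous (by fun_prop) (fun s => Set.mem_Ici.2 (le_max_right _ _))
  have e1 : ∫ s in (0:ℝ)..τ, (a (max s 0) - ahat 0) =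
      ∫ s in (0:ℝ)..τ, ((∑' α, f α s) + aflat (max s 0)) := by
    refine intervalIntegral.integral_congr fun s hs => ?_
    rw [Set.uIcc_of_le hτ] at hs
    simp only [max_eq_left hs.1]
    rw [ha.decomp s hs.1, hS]; abel
  rw [e1, intervalIntegral.integral_add (hSc.intervalIntegrable _ _) (hflc.intervalIntegrable _ _)]
  have e2 : HasSum (fun α => ∫ s in (0:ℝ)..τ, f α s) (∫ s in (0:ℝ)..τ, ∑' α, f α s) := by
    refine intervalIntegral.hasSum_integral_of_dominated_convergence (fun α _ => ‖ahat α‖)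
      (fun α => (hfc α).aestronglyMeasurable) ?_ ?_ ?_ ?_
    · exact fun α => Eventually.of_forall fun s _ => hfn α s
    · exact Eventually.of_forall fun s _ => hsum
    · exact intervalIntegrable_const
    · exact Eventually.of_forall fun s _ =>
        (Summable.of_norm_bounded hsum (fun α => hfn α s)).hasSum
  have b1 : ‖∫ s in (0:ℝ)..τ, ∑' α, f α s‖ ≤
      ∑' α, K * (Real.exp (μ * absIdx α) * ‖ahat α‖) := by
    rw [← e2.tsum_eq]
    exact tsum_of_norm_bounded hsK.hasSum (fun α => hbound α τ)
  have b2 : ‖∫ s in (0:ℝ)..τ, aflat (max s 0)‖ ≤ F := by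
    have hi : IntervalIntegrable (fun s => F * Real.exp (-s)) volume 0 τ :=
      Continuous.intervalIntegrable (by fun_prop) _ _
    refine (intervalIntegral.norm_integral_le_of_norm_le hτ
      (Eventually.of_forall fun s hs => ?_) hi).trans ?_
    · rw [max_eq_left hs.1.le]; exact hF' s hs.1.le
    · rw [intervalIntegral.integral_const_mul, intervalIntegral.integral_comp_neg (fun x => Real.exp x),
        integral_exp]
      simp only [neg_zero, Real.exp_zero]
      nlinarith [Real.exp_pos (-τ)]
  refine (norm_add_le _ _).trans ?_
  linarith

set_option maxHeartbeats 1000000 in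
lemma euler_core {X : Type*} [NormedAddCommGroup X] [NormedSpace ℂ X]
    (a G D : ℝ → (X →L[ℂ] X)) (A : X →L[ℂ] X) (P B V T ε : ℝ) (u₀ : X)
    (hP : 0 < P) (hB : 0 < B) (hV : 0 ≤ V) (hT : 0 < T) (hε : 0 < ε) (hε1 : ε ≤ 1)
    (hεB : ε * B ≤ 1)
    (hD : ∀ τ, D τ = G τ ∘L A - a τ ∘L G τ)
    (hGd : ∀ τ, 0 ≤ τ → HasDerivWithinAt G (a τ - A) (Set.Ici 0) τ)
    (hG0 : G 0 = 0) (hGB : ∀ τ, 0 ≤ τ → ‖G τ‖ ≤ B)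
    (haP : ∀ τ, 0 ≤ τ → ‖a τ‖ ≤ P) (hAP : ‖A‖ ≤ P)
    (haL : ∀ σ, 0 ≤ σ → ∀ τ, 0 ≤ τ → ‖a σ - a τ‖ ≤ P * |σ - τ|)
    (v : ℝ → X) (hv : ∀ t, HasDerivAt v (A (v t)) t) (hv0 : v 0 = u₀)
    (hvV : ∀ t ∈ Set.Icc 0 T, ‖v t‖ ≤ V)
    (W W1 D1 Q : ℝ) (hW : W = 2 * B * V * Real.exp (P * T)) (hW1 : W1 = P * W + 2 * P * B * V)
    (hD1 : D1 = 2 * P * P + P * B + P * (2 * P))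
    (hQ : Q = P * W + P * W1 + D1 * V + 2 * P * B * (P * V) + P * (P * V))
    (h : ℝ) (N : ℕ) (hh : 0 < h) (hN : N * h = T)
    (vs ws : ℕ → X) (hvs0 : vs 0 = u₀) (hws0 : ws 0 = 0)
    (hvs : ∀ l, vs (l + 1) = vs l + h • A (vs l))
    (hws : ∀ l : ℕ, ws (l + 1) = ws l + h • (a ((l * h) / ε) (ws l) -
      (ε • D ((l * h) / ε)) (vs l)))
    (u : ℝ → X) (hu0 : u 0 = u₀)
    (hu : ∀ t ∈ Set.Icc (0:ℝ) T, HasDerivWithinAt u ((a (t / ε)) (u t)) (Set.Icc 0 T) t)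
    (l : ℕ) (hl : l ≤ N) :
    ‖(1 + ε • G ((l * h) / ε)) (vs l) + ws l - u (l * h)‖ ≤
      2 * (2 * Q * T * Real.exp ((P + 2 * P * B) * T)) * h := by
  have hW0 : 0 ≤ W := by rw [hW]; positivity
  have hW10 : 0 ≤ W1 := by rw [hW1]; positivity
  have hD10 : 0 ≤ D1 := by rw [hD1]; positivity
  have hQ0 : 0 ≤ Q := by rw [hQ]; positivity
  have hdiv : ∀ t ∈ Set.Icc 0 T, 0 ≤ t / ε := fun t ht => div_nonneg ht.1 hε.le
  have hDB : ∀ τ, 0 ≤ τ → ‖D τ‖ ≤ 2 * P * B := by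
    intro τ hτ
    rw [hD]
    have h1 := ContinuousLinearMap.opNorm_comp_le (G τ) A
    have h2 := ContinuousLinearMap.opNorm_comp_le (a τ) (G τ)
    have h3 : ‖G τ‖ * ‖A‖ ≤ B * P := mul_le_mul (hGB τ hτ) hAP (norm_nonneg _) hB.le
    have h4 : ‖a τ‖ * ‖G τ‖ ≤ P * B := mul_le_mul (haP τ hτ) (hGB τ hτ) (norm_nonneg _) hP.le
    have := norm_sub_le (G τ ∘L A) (a τ ∘L G τ)
    linarith
  have hGL : ∀ σ, 0 ≤ σ → ∀ τ, 0 ≤ τ → ‖G σ - G τ‖ ≤ (2 * P) * |σ - τ| := by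
    intro σ hσ τ hτ
    refine Convex.norm_image_sub_le_of_norm_hasDerivWithin_le (𝕜 := ℝ) (s := Set.Ici 0) hGd
      (fun x hx => ?_) (convex_Ici 0) hτ hσ
    have := norm_sub_le (a x) A
    have := haP x hx
    linarith
  have hDL : ∀ σ, 0 ≤ σ → ∀ τ, 0 ≤ τ → ‖D σ - D τ‖ ≤ D1 * |σ - τ| := by
    intro σ hσ τ hτ
    have e : D σ - D τ = (G σ - G τ) ∘L A - (a σ - a τ) ∘L G σ - a τ ∘L (G σ - G τ) := by
      rw [hD, hD]; ext x; simp; abel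
    rw [e]
    have h1 := (ContinuousLinearMap.opNorm_comp_le (G σ - G τ) A).trans
      (mul_le_mul (hGL σ hσ τ hτ) hAP (norm_nonneg _) (by positivity))
    have h2 := (ContinuousLinearMap.opNorm_comp_le (a σ - a τ) (G σ)).trans
      (mul_le_mul (haL σ hσ τ hτ) (hGB σ hσ) (norm_nonneg _) (by positivity))
    have h3 := (ContinuousLinearMap.opNorm_comp_le (a τ) (G σ - G τ)).trans
      (mul_le_mul (haP τ hτ) (hGL σ hσ τ hτ) (norm_nonneg _) hP.le)
    refine (norm_sub_le _ _).trans ((add_le_add_left (norm_sub_le _ _) _).trans ?_)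
    rw [hD1]; nlinarith
  -- micro part
  set w : ℝ → X := fun t => u t - (1 + ε • G (t / ε)) (v t) with hw
  set f : ℝ → X := fun t => a (t / ε) (w t) - ε • D (t / ε) (v t) with hf
  have hwd : ∀ t ∈ Set.Icc 0 T, HasDerivWithinAt w (f t) (Set.Icc 0 T) t := by
    intro t ht
    have g1 : HasDerivWithinAt (fun t : ℝ => t / ε) (1 / ε) (Set.Icc 0 T) t :=
      (hasDerivWithinAt_id t _).div_const ε
    have g2 : HasDerivWithinAt (fun t => G (t / ε)) ((1 / ε) • (a (t / ε) - A)) (Set.Icc 0 T) t :=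
      HasDerivWithinAt.scomp (t' := Set.Ici 0) t (hGd _ (hdiv t ht)) g1 hdiv
    have g3 := (g2.const_smul ε).const_add (1 : X →L[ℂ] X)
    have g4 := (hu t ht).sub (clm_apply_deriv g3 (hv t).hasDerivWithinAt)
    refine g4.congr_deriv ?_
    simp only [hf, hw, hD, smul_smul, mul_one_div_cancel hε.ne', one_smul]
    simp [smul_sub]
    abel
  have hvL : ∀ s ∈ Set.Icc 0 T, ∀ s' ∈ Set.Icc 0 T, ‖v s - v s'‖ ≤ (P * V) * |s - s'| := by
    intro s hs s' hs'
    refine Convex.norm_image_sub_le_of_norm_hasDerivWithin_le (𝕜 := ℝ) (s := Set.Icc 0 T)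
      (fun x hx => (hv x).hasDerivWithinAt)
      (fun x hx => ?_) (convex_Icc 0 T) hs' hs
    exact (A.le_opNorm _).trans (mul_le_mul hAP (hvV x hx) (norm_nonneg _) hP.le)
  have hDv : ∀ t ∈ Set.Icc 0 T, ‖ε • D (t / ε) (v t)‖ ≤ ε * (2 * P * B * V) := by
    intro t ht
    rw [norm_smul, Real.norm_of_nonneg hε.le]
    refine mul_le_mul_of_nonneg_left ?_ hε.le
    exact ((D (t / ε)).le_opNorm _).trans
      (mul_le_mul (hDB _ (hdiv t ht)) (hvV t ht) (norm_nonneg _) (by positivity))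
  have haw : ∀ t ∈ Set.Icc 0 T, ‖a (t / ε) (w t)‖ ≤ P * ‖w t‖ := fun t ht =>
    ((a (t / ε)).le_opNorm _).trans (mul_le_mul_of_nonneg_right (haP _ (hdiv t ht)) (norm_nonneg _))
  have hw0 : w 0 = 0 := by simp [hw, hu0, hv0, hG0]
  have hwW : ∀ t ∈ Set.Icc 0 T, ‖w t‖ ≤ ε * W := by
    intro t ht
    have := norm_le_gronwallBound_of_norm_deriv_right_le (f := w) (f' := f) (δ := 0) (K := P)
      (ε := ε * (2 * P * B * V)) (a := 0) (b := T)
      (fun x hx => (hwd x hx).continuousWithinAt)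
      (fun x hx => (hwd x (Set.Ico_subset_Icc_self hx)).mono_of_mem_nhdsWithin
        (Icc_mem_nhdsGE_of_mem hx))
      (by simp [hw0])
      (fun x hx => (norm_sub_le _ _).trans (add_le_add (haw x (Set.Ico_subset_Icc_self hx))
        (hDv x (Set.Ico_subset_Icc_self hx)))) t ht
    refine this.trans ?_
    rw [gronwallBound_of_K_ne_0 hP.ne']
    simp only [zero_mul, zero_add, sub_zero]
    have e : ε * (2 * P * B * V) / P = ε * (2 * B * V) := by field_simp
    rw [e, hW]
    have h1 : Real.exp (P * t) - 1 ≤ Real.exp (P * T) := by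
      have : Real.exp (P * t) ≤ Real.exp (P * T) :=
        Real.exp_le_exp.2 (mul_le_mul_of_nonneg_left ht.2 hP.le)
      linarith
    calc ε * (2 * B * V) * (Real.exp (P * t) - 1) ≤ ε * (2 * B * V) * Real.exp (P * T) :=
          mul_le_mul_of_nonneg_left h1 (by positivity)
      _ = _ := by ring
  have hwL : ∀ s ∈ Set.Icc 0 T, ∀ s' ∈ Set.Icc 0 T, ‖w s - w s'‖ ≤ W1 * |s - s'| := by
    intro s hs s' hs'
    refine Convex.norm_image_sub_le_of_norm_hasDerivWithin_le (𝕜 := ℝ) (s := Set.Icc 0 T)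
      hwd (fun x hx => ?_) (convex_Icc 0 T) hs' hs
    refine (norm_sub_le _ _).trans ?_
    have h1 := haw x hx
    have h2 := hDv x hx
    have h3 : P * ‖w x‖ ≤ P * W := mul_le_mul_of_nonneg_left
      ((hwW x hx).trans (mul_le_of_le_one_left hW0 hε1)) hP.le
    have h4 : ε * (2 * P * B * V) ≤ 2 * P * B * V := mul_le_of_le_one_left (by positivity) hε1
    rw [hW1]; linarith
  have hfL : ∀ s ∈ Set.Icc 0 T, ∀ s' ∈ Set.Icc 0 T, ‖f s - f s'‖ ≤ Q * |s - s'| := by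
    intro s hs s' hs'
    have hss : |s / ε - s' / ε| = |s - s'| / ε := by
      rw [← sub_div, abs_div, abs_of_pos hε]
    have e : f s - f s' = (a (s / ε) - a (s' / ε)) (w s) + a (s' / ε) (w s - w s')
        - (ε • (D (s / ε) - D (s' / ε)) (v s) + ε • D (s' / ε) (v s - v s')) := by
      simp only [hf, ContinuousLinearMap.sub_apply, map_sub, smul_sub]; abel
    have h1 : ‖(a (s / ε) - a (s' / ε)) (w s)‖ ≤ P * W * |s - s'| := by
      refine (ContinuousLinearMap.le_opNorm _ _).trans ((mul_le_mul
        (haL _ (hdiv s hs) _ (hdiv s' hs')) (hwW s hs) (norm_nonneg _) (by positivity)).trans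
          (le_of_eq ?_))
      rw [hss]; field_simp
    have h2 : ‖a (s' / ε) (w s - w s')‖ ≤ P * W1 * |s - s'| := by
      refine (ContinuousLinearMap.le_opNorm _ _).trans ((mul_le_mul
        (haP _ (hdiv s' hs')) (hwL s hs s' hs') (norm_nonneg _) (by positivity)).trans
          (le_of_eq ?_))
      ring
    have h3 : ‖ε • (D (s / ε) - D (s' / ε)) (v s)‖ ≤ D1 * V * |s - s'| := by
      rw [norm_smul, Real.norm_of_nonneg hε.le]
      refine (mul_le_mul_of_nonneg_left ((ContinuousLinearMap.le_opNorm _ _).trans (mul_le_mul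
        (hDL _ (hdiv s hs) _ (hdiv s' hs')) (hvV s hs) (norm_nonneg _) (by positivity))) hε.le).trans
          (le_of_eq ?_)
      rw [hss]; field_simp
    have h4 : ‖ε • D (s' / ε) (v s - v s')‖ ≤ 2 * P * B * (P * V) * |s - s'| := by
      rw [norm_smul, Real.norm_of_nonneg hε.le]
      refine (mul_le_of_le_one_left (norm_nonneg _) hε1).trans ?_
      refine (ContinuousLinearMap.le_opNorm _ _).trans ((mul_le_mul
        (hDB _ (hdiv s' hs')) (hvL s hs s' hs') (norm_nonneg _) (by positivity)).trans
          (le_of_eq ?_))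
      ring
    have h5 : 0 ≤ P * (P * V) * |s - s'| := by positivity
    rw [e]
    refine (norm_sub_le _ _).trans ((add_le_add (norm_add_le _ _) (norm_add_le _ _)).trans ?_)
    rw [hQ]
    linarith
  have hAvL : ∀ s ∈ Set.Icc 0 T, ∀ s' ∈ Set.Icc 0 T, ‖A (v s) - A (v s')‖ ≤ Q * |s - s'| := by
    intro s hs s' hs'
    rw [← map_sub]
    refine (A.le_opNorm _).trans ((mul_le_mul hAP (hvL s hs s' hs') (norm_nonneg _) hP.le).trans ?_)
    rw [← mul_assoc]
    refine mul_le_mul_of_nonneg_right ?_ (abs_nonneg _)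
    rw [hQ]
    have : 0 ≤ P * W + P * W1 + D1 * V + 2 * P * B * (P * V) := by positivity
    linarith
  -- discrete error
  have hmem : ∀ k : ℕ, k ≤ N → (k * h) ∈ Set.Icc 0 T := by
    intro k hk
    refine ⟨by positivity, ?_⟩
    rw [← hN]
    exact mul_le_mul_of_nonneg_right (by exact_mod_cast hk) hh.le
  set E : ℕ → ℝ := fun k => ‖vs k - v (k * h)‖ + ‖ws k - w (k * h)‖ with hE
  have hE0 : E 0 = 0 := by simp [hE, hvs0, hv0, hws0, hw0]
  have hstep : ∀ k < N, E (k + 1) ≤ (1 + h * (P + 2 * P * B)) * E k + (2 * Q) * h ^ 2 := by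
    intro k hk
    have ht := hmem k hk.le
    have ht1 := hmem (k + 1) hk
    have hk1 : ((k + 1 : ℕ) : ℝ) * h = k * h + h := by push_cast; ring
    rw [hk1] at ht1
    have t1 := taylor_lip hQ0 (fun s hs => (hv s).hasDerivWithinAt) hAvL ht.1 hh.le ht1.2
    have t2 := taylor_lip hQ0 hwd hfL ht.1 hh.le ht1.2
    set t : ℝ := k * h with htdef
    have e1 : vs (k + 1) - v (t + h) = (vs k - v t) + h • A (vs k - v t)
        - (v (t + h) - v t - h • A (v t)) := by
      rw [hvs, map_sub, smul_sub]; abel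
    have e2 : ws (k + 1) - w (t + h) = (ws k - w t) + h • (a (t / ε) (ws k - w t))
        - h • (ε • D (t / ε) (vs k - v t)) - (w (t + h) - w t - h • f t) := by
      rw [hws]
      simp only [hf, map_sub, smul_sub, ContinuousLinearMap.smul_apply]; abel
    have n1 : ‖h • A (vs k - v t)‖ ≤ h * (P * ‖vs k - v t‖) := by
      rw [norm_smul, Real.norm_of_nonneg hh.le]
      exact mul_le_mul_of_nonneg_left ((A.le_opNorm _).trans
        (mul_le_mul_of_nonneg_right hAP (norm_nonneg _))) hh.le
    have n2 : ‖h • (a (t / ε) (ws k - w t))‖ ≤ h * (P * ‖ws k - w t‖) := by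
      rw [norm_smul, Real.norm_of_nonneg hh.le]
      exact mul_le_mul_of_nonneg_left (((a (t / ε)).le_opNorm _).trans
        (mul_le_mul_of_nonneg_right (haP _ (hdiv t ht)) (norm_nonneg _))) hh.le
    have n3 : ‖h • (ε • D (t / ε) (vs k - v t))‖ ≤ h * (2 * P * B * ‖vs k - v t‖) := by
      rw [norm_smul, Real.norm_of_nonneg hh.le, norm_smul, Real.norm_of_nonneg hε.le]
      refine mul_le_mul_of_nonneg_left ((mul_le_of_le_one_left (norm_nonneg _) hε1).trans ?_) hh.le
      exact (((D (t / ε)).le_opNorm _).trans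
        (mul_le_mul_of_nonneg_right (hDB _ (hdiv t ht)) (norm_nonneg _)))
    have m1 : ‖vs (k + 1) - v (t + h)‖ ≤ ‖vs k - v t‖ + h * (P * ‖vs k - v t‖) + Q * h ^ 2 := by
      rw [e1]
      refine (norm_sub_le _ _).trans (add_le_add ((norm_add_le _ _).trans ?_) t1)
      linarith
    have m2 : ‖ws (k + 1) - w (t + h)‖ ≤ ‖ws k - w t‖ + h * (P * ‖ws k - w t‖)
        + h * (2 * P * B * ‖vs k - v t‖) + Q * h ^ 2 := by
      rw [e2]
      refine (norm_sub_le _ _).trans (add_le_add ((norm_sub_le _ _).trans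
        (add_le_add ((norm_add_le _ _).trans ?_) n3)) t2)
      linarith
    have p0 : 0 ≤ h * (2 * P * B * ‖ws k - w t‖) := by positivity
    simp only [hE, hk1]
    rw [← htdef]
    linarith
  have hEl := euler_discrete_gronwall hh.le (by positivity) (by positivity) hE0 hstep l hl
  rw [hN] at hEl
  have htl := hmem l hl
  set t : ℝ := l * h with htdef
  have e : (1 + ε • G (t / ε)) (vs l) + ws l - u t =
      (1 + ε • G (t / ε)) (vs l - v t) + (ws l - w t) := by
    simp only [hw, map_sub]; abel
  have hΦ : ‖(1 + ε • G (t / ε)) (vs l - v t)‖ ≤ 2 * ‖vs l - v t‖ := by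
    have e' : (1 + ε • G (t / ε)) (vs l - v t) = (vs l - v t) + ε • G (t / ε) (vs l - v t) := by
      simp
    rw [e']
    refine (norm_add_le _ _).trans ?_
    rw [norm_smul, Real.norm_of_nonneg hε.le]
    have h1 := mul_le_mul_of_nonneg_left (((G (t / ε)).le_opNorm (vs l - v t)).trans
      (mul_le_mul_of_nonneg_right (hGB _ (hdiv t htl)) (norm_nonneg _))) hε.le
    have h2 := mul_le_mul_of_nonneg_right hεB (norm_nonneg (vs l - v t))
    linarith
  rw [e]
  refine (norm_add_le _ _).trans ?_
  have hEt : E l = ‖vs l - v t‖ + ‖ws l - w t‖ := rfl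
  have := norm_nonneg (ws l - w t)
  linarith

/-- uniform accuracy of the explicit Euler scheme for the
micro-macro problem. Under the Diophantine condition, for `a` sharp-flat of class `μ`
with `𝒩_μ(a) ≤ M`, of class `C¹` with `‖a‖, ‖∂_τ a‖ ≤ C_a M`, `n ≥ 1`, `T > 0` and
`u₀ ∈ X`, there are `ε_n > 0` and `C > 0` such that for every `0 < ε ≤ ε_n` there are a
`C²` map `Φ` with `‖Φ − id‖ ≤ c` (so that `Φ₀` is invertible, with inverse `Ψ`) and
`A ∈ End(X)` such that the explicit Euler scheme applied to the micro-macro problem,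
initialized with `v⁰ = Ψu₀`, `w⁰ = 0`, satisfies
`max_{0≤ℓ≤L} ‖Φ_{t^ℓ/ε} v^ℓ + w^ℓ − u^ε(t^ℓ)‖ ≤ C Δt` with `Δt = T/L`, `t^ℓ = ℓΔt`,
uniformly in `ε` and `L`. -/
theorem euler_uniform_accuracy
    {r : ℕ} (ω : Fin r → ℝ) (c_D ν : ℝ) (hcD : 0 < c_D) (hν : 0 < ν)
    (hdio : ∀ α : Fin r → ℤ, α ≠ 0 → c_D / (absIdx α) ^ ν ≤ |dotIdx ω α|)
    (μ M C_a c : ℝ) (hμ : 0 < μ) (hM : 0 < M) (hCa : 0 < C_a) (hc0 : 0 < c) (hc1 : c < 1)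
    (a : ℝ → (X →L[ℂ] X))
    (ahat : (Fin r → ℤ) → (X →L[ℂ] X)) (aflat : ℝ → (X →L[ℂ] X))
    (ha : IsSharpFlat ω μ a ahat aflat) (haM : SFNorm μ ahat aflat ≤ M)
    (haC1 : ContDiffOn ℝ 1 a (Set.Ici 0))
    (habd : ∀ τ : ℝ, 0 ≤ τ → ‖a τ‖ ≤ C_a * M)
    (hadbd : ∀ τ : ℝ, 0 ≤ τ → ‖derivWithin a (Set.Ici 0) τ‖ ≤ C_a * M)
    (n : ℕ) (hn : 1 ≤ n) (T : ℝ) (hT : 0 < T) (u₀ : X) :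
    ∃ εn : ℝ, 0 < εn ∧ ∃ C : ℝ, 0 < C ∧
      ∀ ε : ℝ, 0 < ε → ε ≤ εn →
        ∃ (Φ : ℝ → (X →L[ℂ] X)) (A Ψ : X →L[ℂ] X),
          ContDiffOn ℝ 2 Φ (Set.Ici 0) ∧
          (∀ τ : ℝ, 0 ≤ τ → ‖Φ τ - 1‖ ≤ c) ∧
          (Φ 0) ∘L Ψ = 1 ∧ Ψ ∘L (Φ 0) = 1 ∧
          ∀ L : ℕ, 0 < L →
            ∀ vs ws : ℕ → X,
              vs 0 = Ψ u₀ → ws 0 = 0 →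
              (∀ ℓ : ℕ, vs (ℓ + 1) = vs ℓ + (T / (L : ℝ)) • (A (vs ℓ))) →
              (∀ ℓ : ℕ, ws (ℓ + 1) = ws ℓ + (T / (L : ℝ)) •
                ((a (((ℓ : ℝ) * (T / (L : ℝ))) / ε)) (ws ℓ) -
                  ((ε⁻¹ • derivWithin Φ (Set.Ici 0) (((ℓ : ℝ) * (T / (L : ℝ))) / ε) -
                      (a (((ℓ : ℝ) * (T / (L : ℝ))) / ε) ∘L
                          Φ (((ℓ : ℝ) * (T / (L : ℝ))) / ε) -
                        Φ (((ℓ : ℝ) * (T / (L : ℝ))) / ε) ∘L A))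
                    (vs ℓ)))) →
              ∀ u : ℝ → X, u 0 = u₀ →
                (∀ t ∈ Set.Icc (0:ℝ) T,
                  HasDerivWithinAt u ((a (t / ε)) (u t)) (Set.Icc 0 T) t) →
                ∀ ℓ : ℕ, ℓ ≤ L →
                  ‖(Φ (((ℓ : ℝ) * (T / (L : ℝ))) / ε)) (vs ℓ) + ws ℓ -
                      u ((ℓ : ℝ) * (T / (L : ℝ)))‖ ≤ C * (T / (L : ℝ)) := by
  obtain ⟨B, hB, hGB⟩ := avg_bound ω c_D ν hcD hν hdio μ hμ a ahat aflat ha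
  set A : X →L[ℂ] X := ahat 0 with hA
  set G : ℝ → (X →L[ℂ] X) := fun τ => ∫ s in (0:ℝ)..τ, (a (max s 0) - A) with hG
  have hCM : 0 < C_a * M := mul_pos hCa hM
  have hbc : Continuous fun s => a (max s 0) - A :=
    (haC1.continuousOn.comp_continuous (by fun_prop)
      (fun s => Set.mem_Ici.2 (le_max_right _ _))).sub continuous_const
  have hGd : ∀ τ, 0 ≤ τ → HasDerivWithinAt G (a τ - A) (Set.Ici 0) τ := by
    intro τ hτ
    have := (hbc.integral_hasStrictDerivAt 0 τ).hasDerivAt.hasDerivWithinAt (s := Set.Ici 0)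
    rwa [max_eq_left hτ] at this
  have hG0 : G 0 = 0 := by simp [hG]
  set v : ℝ → X := fun t => NormedSpace.exp (t • A) u₀ with hvdef
  have hv : ∀ t, HasDerivAt v (A (v t)) t := by
    intro t
    have h1 : HasDerivAt (fun s : ℝ => NormedSpace.exp (s • A)) (A * NormedSpace.exp (t • A)) t :=
      hasDerivAt_exp_smul_const' (𝕂 := ℝ) A t
    have h2 := clm_apply_deriv h1.hasDerivWithinAt (s := Set.univ)
      (hasDerivWithinAt_const t Set.univ u₀)
    rw [hasDerivWithinAt_univ] at h2
    simpa using h2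
  have hv0 : v 0 = u₀ := by simp [hvdef]
  obtain ⟨V, hvV⟩ := (isCompact_Icc (a := (0:ℝ)) (b := T)).exists_bound_of_continuousOn (f := v)
    (fun t _ => (hv t).continuousAt.continuousWithinAt)
  have hV : 0 ≤ V := (norm_nonneg _).trans (hvV 0 ⟨le_rfl, hT.le⟩)
  set P : ℝ := C_a * M + ‖A‖ with hP
  have hP0 : 0 < P := by positivity
  have haP : ∀ τ, 0 ≤ τ → ‖a τ‖ ≤ P := fun τ hτ => by
    have := habd τ hτ; have := norm_nonneg A; linarith
  have hAP : ‖A‖ ≤ P := by linarith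
  have haL : ∀ σ, 0 ≤ σ → ∀ τ, 0 ≤ τ → ‖a σ - a τ‖ ≤ P * |σ - τ| := by
    intro σ hσ τ hτ
    refine Convex.norm_image_sub_le_of_norm_derivWithin_le (𝕜 := ℝ) (s := Set.Ici 0)
      (haC1.differentiableOn (by norm_num)) (fun x hx => ?_) (convex_Ici 0) hτ hσ
    have := hadbd x hx; have := norm_nonneg A; linarith
  obtain ⟨W, hW⟩ : ∃ W, W = 2 * B * V * Real.exp (P * T) := ⟨_, rfl⟩
  obtain ⟨W1, hW1⟩ : ∃ W1, W1 = P * W + 2 * P * B * V := ⟨_, rfl⟩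
  obtain ⟨D1, hD1⟩ : ∃ D1, D1 = 2 * P * P + P * B + P * (2 * P) := ⟨_, rfl⟩
  obtain ⟨Q, hQ⟩ : ∃ Q, Q = P * W + P * W1 + D1 * V + 2 * P * B * (P * V) + P * (P * V) :=
    ⟨_, rfl⟩
  have hW0 : 0 ≤ W := by rw [hW]; positivity
  have hW10 : 0 ≤ W1 := by rw [hW1]; positivity
  have hD10 : 0 ≤ D1 := by rw [hD1]; positivity
  have hQ0 : 0 ≤ Q := by rw [hQ]; positivity
  refine ⟨min 1 (c / B), lt_min one_pos (div_pos hc0 hB),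
    2 * (2 * Q * T * Real.exp ((P + 2 * P * B) * T)) + 1, by positivity, ?_⟩
  intro ε hε hεn
  have hε1 : ε ≤ 1 := hεn.trans (min_le_left _ _)
  have hεB : ε * B ≤ c := (le_div_iff₀ hB).1 (hεn.trans (min_le_right _ _))
  set Φ : ℝ → (X →L[ℂ] X) := fun τ => 1 + ε • G τ with hΦ
  have hΦd : ∀ τ ∈ Set.Ici (0:ℝ), HasDerivWithinAt Φ (ε • (a τ - A)) (Set.Ici 0) τ :=
    fun τ hτ => ((hGd τ hτ).const_smul ε).const_add 1
  have hud : UniqueDiffOn ℝ (Set.Ici (0:ℝ)) := uniqueDiffOn_Ici 0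
  have hΦd' : ∀ τ ∈ Set.Ici (0:ℝ), derivWithin Φ (Set.Ici 0) τ = ε • (a τ - A) :=
    fun τ hτ => (hΦd τ hτ).derivWithin (hud τ hτ)
  refine ⟨Φ, A, 1, ?_, ?_, ?_, ?_, ?_⟩
  · rw [show (2 : WithTop ℕ∞) = 1 + 1 by norm_num, contDiffOn_succ_iff_derivWithin hud]
    refine ⟨fun τ hτ => (hΦd τ hτ).differentiableWithinAt, by simp, ?_⟩
    exact ((haC1.sub contDiffOn_const).const_smul ε).congr hΦd'
  · intro τ hτ
    simp only [hΦ, add_sub_cancel_left]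
    rw [norm_smul, Real.norm_of_nonneg hε.le]
    exact (mul_le_mul_of_nonneg_left (hGB τ hτ) hε.le).trans hεB
  · ext x; simp [hΦ, hG0]
  · ext x; simp [hΦ, hG0]
  intro L hL vs ws hvs0 hws0 hvs hws u hu0 hu l hl
  have hL' : (0:ℝ) < L := by exact_mod_cast hL
  have hh : 0 < T / (L:ℝ) := by positivity
  have key := euler_core a G (fun τ => G τ ∘L A - a τ ∘L G τ) A P B V T ε u₀ hP0 hB hV hT hε hε1
    (hεB.trans hc1.le) (fun _ => rfl) hGd hG0 hGB haP hAP haL v hv hv0 hvV W W1 D1 Q hW hW1 hD1 hQ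
    (T / (L:ℝ)) L hh (by field_simp) vs ws (by simpa using hvs0) hws0 hvs
    (fun k => by
      rw [hws k, hΦd' _ (Set.mem_Ici.2 (by positivity))]
      congr 4
      rw [smul_smul, inv_mul_cancel₀ hε.ne', one_smul]
      ext x
      simp [hΦ, smul_sub]
      abel)
    u hu0 hu l hl
  refine key.trans ?_
  nlinarith
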